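/- arXiv:2401.06626 — 6 statements merged into one kernel-verified Lean document; each statement's English description precedes it below -/
import Mathlib

section
/- Let m ≥ 1 and w ≥ 1 be integers with 2^w ≥ m + 3, and let 0 ≤ c < m be an integer. Then m·(m+1)·C(m,c)·(2^w − 1)^c ≥ 2^w · S_{c−1}, where C(m,c) denotes the binomial coefficient. -/
theorem aux_stmt0 (m q : ℕ) (hq : m + 2 ≤ q) (c : ℕ) (hc : c < m) :
    (q + 1) * ∑ j ∈ Finset.range c, m.choose j * q ^ j ≤
      m * (m + 1) * m.choose c * q ^ c := by
  induction c with
  | zero => simp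
  | succ c ih =>
    have ih := ih (by omega)
    rw [Finset.sum_range_succ]
    obtain ⟨d, hd⟩ : ∃ d, m = c + 2 + d := ⟨m - (c + 2), by omega⟩
    have h1 := Nat.choose_succ_right_eq m c
    have h2 : m - c = d + 2 := by omega
    rw [h2] at h1
    set S := ∑ j ∈ Finset.range c, m.choose j * q ^ j
    have key : (m * (m + 1) + q + 1) * (c + 1) ≤ m * (m + 1) * q * (d + 2) := by
      have e1 : (m * (m + 1) + q + 1) * (c + 1) ≤ (m * (m + 1) + q + 1) * m :=
        Nat.mul_le_mul_left _ (by omega)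
      have e2 : m * (m + 1) * q * 2 ≤ m * (m + 1) * q * (d + 2) :=
        Nat.mul_le_mul_left _ (by omega)
      have e3 : m * (m + 1) * m ≤ m * (m + 1) * q := Nat.mul_le_mul_left _ (by omega)
      have e4 : (q + 1) * m ≤ m * (m + 1) * q := by
        have : q + 1 ≤ (m + 1) * q := by nlinarith
        nlinarith
      nlinarith
    refine Nat.le_of_mul_le_mul_right (c := c + 1) ?_ (by omega)
    calc (q + 1) * (S + m.choose c * q ^ c) * (c + 1)
        = ((q + 1) * S + (q + 1) * (m.choose c * q ^ c)) * (c + 1) := by ring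
      _ ≤ (m * (m + 1) * m.choose c * q ^ c + (q + 1) * (m.choose c * q ^ c)) * (c + 1) := by
          gcongr
      _ = ((m * (m + 1) + q + 1) * (c + 1)) * (m.choose c * q ^ c) := by ring
      _ ≤ (m * (m + 1) * q * (d + 2)) * (m.choose c * q ^ c) := Nat.mul_le_mul_right _ key
      _ = m * (m + 1) * (m.choose c * (d + 2)) * q ^ (c + 1) := by ring
      _ = m * (m + 1) * m.choose (c + 1) * q ^ (c + 1) * (c + 1) := by rw [← h1]; ring

/-- For integers `m ≥ 1`, `w ≥ 1` with `2^w ≥ m + 3` and `0 ≤ c < m`,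
we have `m·(m+1)·C(m,c)·(2^w − 1)^c ≥ 2^w · S_{c−1}`, where
`S_{c-1} = Σ_{j=0}^{c-1} C(m,j)·(2^w − 1)^j` (so `S_{-1} = 0`). -/
theorem stmt0 (m w c : ℕ) (hm : 1 ≤ m) (hw : 1 ≤ w)
    (hpow : m + 3 ≤ 2 ^ w) (hc : c < m) :
    2 ^ w * ∑ j ∈ Finset.range c, m.choose j * (2 ^ w - 1) ^ j ≤
      m * (m + 1) * m.choose c * (2 ^ w - 1) ^ c := by
  have h := aux_stmt0 m (2 ^ w - 1) (by omega) c hc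
  rwa [Nat.sub_add_cancel (by omega)] at h
end

section
/- Let c ≥ 1 and y ≥ 0 be integers, let R_1 ∪ … ∪ R_k be a partition of the set of all bitstrings of length m·w into k ≤ 2^{m·w − y} parts, and let ψ'_1, …, ψ'_k be bitstrings of length m·w. Then Σ_{i=1}^{k} d_c(R_i, ψ'_i) ≥ 2^{m·w − y} · (2^y − S_{c−1}). -/
theorem ball_card_le (m w c : ℕ) (φ : Fin m → Fin w → Bool) :
    (Finset.univ.filter fun ψ : Fin m → Fin w → Bool => ¬ c ≤ hammingDist ψ φ).card ≤
      ∑ j ∈ Finset.range c, m.choose j * (2 ^ w - 1) ^ j := by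
  classical
  have hsub : (Finset.univ.filter fun ψ : Fin m → Fin w → Bool => ¬ c ≤ hammingDist ψ φ) ⊆
      (Finset.range c).biUnion fun j =>
        (Finset.powersetCard j (Finset.univ : Finset (Fin m))).biUnion fun s =>
          Fintype.piFinset fun i => if i ∈ s then ({φ i}ᶜ : Finset (Fin w → Bool)) else {φ i} := by
    intro ψ hψ
    simp only [Finset.mem_filter, Finset.mem_univ, true_and, not_le] at hψ
    simp only [Finset.mem_biUnion, Finset.mem_range, Finset.mem_powersetCard]
    refine ⟨hammingDist ψ φ, hψ, Finset.univ.filter fun i => ψ i ≠ φ i,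
      ⟨Finset.subset_univ _, rfl⟩, ?_⟩
    rw [Fintype.mem_piFinset]
    intro i
    by_cases h : ψ i = φ i <;> simp [h]
  refine (Finset.card_le_card hsub).trans (Finset.card_biUnion_le.trans ?_)
  refine Finset.sum_le_sum fun j _ => Finset.card_biUnion_le.trans ?_
  refine (Finset.sum_le_card_nsmul _ _ ((2 ^ w - 1) ^ j) ?_).trans ?_
  · intro s hs
    rw [Finset.mem_powersetCard] at hs
    rw [Fintype.card_piFinset]
    have : ∀ i : Fin m, (if i ∈ s then ({φ i}ᶜ : Finset (Fin w → Bool)) else {φ i}).card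
        = if i ∈ s then 2 ^ w - 1 else 1 := by
      intro i
      split_ifs <;> simp [Finset.card_compl]
    simp only [this]
    rw [Finset.prod_ite]
    simp [hs.2]
  · simp [Finset.card_powersetCard]

/-- Let `c ≥ 1`, `0 ≤ y ≤ m·w`, and let `R_1 ∪ … ∪ R_k` be a partition of
all bitstrings of length `m·w` (viewed as `Fin m → Fin w → Bool`, i.e. `m` blocks of `w`
bits) into `k ≤ 2^{m·w − y}` parts, with representatives `ψ'_i`. Then
`Σ_{i} d_c(R_i, ψ'_i) ≥ 2^{m·w − y} · (2^y − S_{c−1})`, where `d_c(R, ψ')` counts the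
`ψ ∈ R` differing from `ψ'` in at least `c` blocks and
`S_{c-1} = Σ_{j=0}^{c-1} C(m,j)·(2^w − 1)^j`. -/
theorem stmt3 (m w c y k : ℕ) (hm : 1 ≤ m) (hw : 1 ≤ w) (hc : 1 ≤ c)
    (hy : y ≤ m * w) (hk : k ≤ 2 ^ (m * w - y))
    (R : Fin k → Finset (Fin m → Fin w → Bool))
    (ψ' : Fin k → Fin m → Fin w → Bool)
    (hdisj : ∀ i j, i ≠ j → Disjoint (R i) (R j))
    (hcover : ∀ ψ, ∃ i, ψ ∈ R i) :
    (2 : ℤ) ^ (m * w - y) *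
        ((2 : ℤ) ^ y - ∑ j ∈ Finset.range c, (m.choose j : ℤ) * ((2 : ℤ) ^ w - 1) ^ j) ≤
      ∑ i : Fin k, (((R i).filter fun ψ => c ≤ hammingDist ψ (ψ' i)).card : ℤ) := by
  classical
  set S : ℕ := ∑ j ∈ Finset.range c, m.choose j * (2 ^ w - 1) ^ j with hS
  have hScast : (∑ j ∈ Finset.range c, (m.choose j : ℤ) * ((2 : ℤ) ^ w - 1) ^ j) = (S : ℤ) := by
    rw [hS]
    push_cast [Nat.one_le_two_pow]
    rfl
  rw [hScast]
  have htot : 2 ^ (m * w) ≤ ∑ i : Fin k, (R i).card := by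
    have h1 : (Finset.univ : Finset (Fin m → Fin w → Bool)) ⊆ Finset.univ.biUnion R := by
      intro ψ _
      simpa using hcover ψ
    have h2 := (Finset.card_le_card h1).trans Finset.card_biUnion_le
    have h3 : (Finset.univ : Finset (Fin m → Fin w → Bool)).card = 2 ^ (m * w) := by
      simp [← pow_mul, mul_comm]
    rwa [h3] at h2
  have hpart : ∀ i : Fin k, (R i).card ≤
      ((R i).filter fun ψ => c ≤ hammingDist ψ (ψ' i)).card + S := by
    intro i
    rw [← Finset.card_filter_add_card_filter_not (s := R i)
      (fun ψ => c ≤ hammingDist ψ (ψ' i))]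
    exact Nat.add_le_add_left ((Finset.card_le_card
      (Finset.filter_subset_filter _ (Finset.subset_univ _))).trans
        (ball_card_le m w c (ψ' i))) _
  have hsum := htot.trans (Finset.sum_le_sum fun i (_ : i ∈ Finset.univ) => hpart i)
  rw [Finset.sum_add_distrib] at hsum
  simp only [Finset.sum_const, Finset.card_univ, Fintype.card_fin, smul_eq_mul] at hsum
  have hkS : k * S ≤ 2 ^ (m * w - y) * S := Nat.mul_le_mul_right _ hk
  have hfin := hsum.trans (Nat.add_le_add_left hkS _)
  have hpow : (2 : ℤ) ^ (m * w - y) * 2 ^ y = 2 ^ (m * w) := by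
    rw [← pow_add, Nat.sub_add_cancel hy]
  rw [mul_sub, hpow]
  have hz : (2 : ℤ) ^ (m * w) ≤
      ∑ i : Fin k, (((R i).filter fun ψ => c ≤ hammingDist ψ (ψ' i)).card : ℤ)
        + 2 ^ (m * w - y) * (S : ℤ) := by exact_mod_cast hfin
  linarith
end

section
/- Let m ≥ 1, w ≥ 1 and y be integers with y ≥ m + w and 2^w ≥ m + 3, and set c = ⌈(y − m − w + 1)/w⌉. Let R_1 ∪ … ∪ R_k be any partition of the set of all bitstrings of length m·w into k ≤ 2^{m·w − y} parts, and for each i let ψ'_i be a bitstring of length m·w. Then the number of bitstrings ψ of length m·w whose block-wise Hamming distance to the representative ψ'_i of the part containing ψ is at least c, is at least 2^{m·w} · (1 − m·(m+1)·2^{−w}). -/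
theorem ball_card (m w r : ℕ) (c : ℕ) (φ : Fin m → Fin w → Bool)
    (h : ∀ d, d < c → w * d ≤ r) :
    (Finset.univ.filter fun ψ : Fin m → Fin w → Bool => ¬ c ≤ hammingDist ψ φ).card
      ≤ 2 ^ m * 2 ^ r := by
  classical
  have hsub : (Finset.univ.filter fun ψ : Fin m → Fin w → Bool => ¬ c ≤ hammingDist ψ φ) ⊆
      ((Finset.univ : Finset (Finset (Fin m))).filter fun S => S.card < c).biUnion fun S =>
        Fintype.piFinset fun i => if i ∈ S then (Finset.univ : Finset (Fin w → Bool)) else {φ i} := by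
    intro ψ hψ
    rw [Finset.mem_filter] at hψ
    rw [Finset.mem_biUnion]
    refine ⟨Finset.univ.filter fun i => ψ i ≠ φ i, ?_, ?_⟩
    · rw [Finset.mem_filter]
      exact ⟨Finset.mem_univ _, not_le.mp hψ.2⟩
    · rw [Fintype.mem_piFinset]
      intro i
      by_cases hi : ψ i = φ i <;> simp [hi]
  have h1 := (Finset.card_le_card hsub).trans Finset.card_biUnion_le
  refine h1.trans ?_
  have h2 : ∀ S ∈ ((Finset.univ : Finset (Finset (Fin m))).filter fun S => S.card < c),
      (Fintype.piFinset fun i => if i ∈ S then (Finset.univ : Finset (Fin w → Bool))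
        else {φ i}).card ≤ 2 ^ r := by
    intro S hS
    rw [Finset.mem_filter] at hS
    rw [Fintype.card_piFinset]
    have : ∀ i, (if i ∈ S then (Finset.univ : Finset (Fin w → Bool)) else {φ i}).card
        = if i ∈ S then 2 ^ w else 1 := by
      intro i
      split_ifs <;> simp
    simp only [this]
    rw [Finset.prod_ite_mem, Finset.univ_inter, Finset.prod_const, ← pow_mul]
    exact Nat.pow_le_pow_right (by norm_num) (h _ hS.2)
  refine (Finset.sum_le_card_nsmul _ _ _ h2).trans ?_
  rw [smul_eq_mul]
  refine Nat.mul_le_mul_right _ ?_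
  refine (Finset.card_filter_le _ _).trans ?_
  simp

/-- Let `m ≥ 1`, `w ≥ 1`, `m + w ≤ y ≤ m·w`, `2^w ≥ m + 3`, and set
`c = ⌈(y − m − w + 1)/w⌉` (computed below as `(y - m - w + 1 + (w - 1)) / w` in ℕ).
Let `R_1 ∪ … ∪ R_k` be any partition of the bitstrings of length `m·w`
(as `Fin m → Fin w → Bool`, i.e. `m` blocks of `w` bits) into `k ≤ 2^{m·w − y}`
parts with representatives `ψ'_i`. Then the number of bitstrings `ψ` whose block-wise
Hamming distance to the representative of the part containing `ψ` is at least `c`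
is at least `2^{m·w} · (1 − m·(m+1)·2^{−w})`. -/
theorem stmt4 (m w y k : ℕ) (hm : 1 ≤ m) (hw : 1 ≤ w)
    (hy : m + w ≤ y) (hy' : y ≤ m * w) (hpow : m + 3 ≤ 2 ^ w)
    (hk : k ≤ 2 ^ (m * w - y))
    (R : Fin k → Finset (Fin m → Fin w → Bool))
    (ψ' : Fin k → Fin m → Fin w → Bool)
    (hdisj : ∀ i j, i ≠ j → Disjoint (R i) (R j))
    (hcover : ∀ ψ, ∃ i, ψ ∈ R i) :
    (2 : ℝ) ^ (m * w) * (1 - m * (m + 1) / 2 ^ w) ≤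
      ∑ i : Fin k,
        (((R i).filter fun ψ =>
          (y - m - w + 1 + (w - 1)) / w ≤ hammingDist ψ (ψ' i)).card : ℝ) := by
  classical
  set c := (y - m - w + 1 + (w - 1)) / w with hc
  have hcd : ∀ d, d < c → w * d ≤ y - m - w := by
    intro d hd
    have h1 : (d + 1) * w ≤ y - m - w + 1 + (w - 1) := (Nat.le_div_iff_mul_le (by omega)).mp hd
    have h2 : (d + 1) * w = w * d + w := by ring
    omega
  have htot : 2 ^ (m * w) ≤ ∑ i : Fin k, (R i).card := by
    have h1 : (Finset.univ : Finset (Fin m → Fin w → Bool)) ⊆ Finset.univ.biUnion R := by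
      intro ψ _
      obtain ⟨i, hi⟩ := hcover ψ
      exact Finset.mem_biUnion.mpr ⟨i, Finset.mem_univ _, hi⟩
    have h2 := (Finset.card_le_card h1).trans Finset.card_biUnion_le
    have h3 : (Finset.univ : Finset (Fin m → Fin w → Bool)).card = 2 ^ (m * w) := by
      simp [← pow_mul, mul_comm]
    rwa [h3] at h2
  have hbad : ∑ i : Fin k, ((R i).filter fun ψ => ¬ c ≤ hammingDist ψ (ψ' i)).card
      ≤ 2 ^ (m * w - w) := by
    have h1 : ∀ i ∈ (Finset.univ : Finset (Fin k)),
        ((R i).filter fun ψ => ¬ c ≤ hammingDist ψ (ψ' i)).card ≤ 2 ^ m * 2 ^ (y - m - w) := by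
      intro i _
      exact (Finset.card_le_card (Finset.filter_subset_filter _ (Finset.subset_univ _))).trans
        (ball_card m w _ c (ψ' i) hcd)
    refine (Finset.sum_le_card_nsmul _ _ _ h1).trans ?_
    rw [Finset.card_univ, Fintype.card_fin, smul_eq_mul]
    refine (Nat.mul_le_mul_right _ hk).trans ?_
    rw [← pow_add, ← pow_add]
    exact Nat.pow_le_pow_right (by norm_num) (by omega)
  have hsplit : ∑ i : Fin k, (R i).card =
      ∑ i : Fin k, ((R i).filter fun ψ => c ≤ hammingDist ψ (ψ' i)).card +
      ∑ i : Fin k, ((R i).filter fun ψ => ¬ c ≤ hammingDist ψ (ψ' i)).card := by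
    rw [← Finset.sum_add_distrib]
    exact Finset.sum_congr rfl fun i _ =>
      (Finset.card_filter_add_card_filter_not _).symm
  have hfin : 2 ^ (m * w) ≤
      ∑ i : Fin k, ((R i).filter fun ψ => c ≤ hammingDist ψ (ψ' i)).card + 2 ^ (m * w - w) := by
    omega
  have hfinR : (2 : ℝ) ^ (m * w) ≤
      ∑ i : Fin k, (((R i).filter fun ψ => c ≤ hammingDist ψ (ψ' i)).card : ℝ)
        + 2 ^ (m * w - w) := by
    exact_mod_cast hfin
  have hpw : (2 : ℝ) ^ (m * w) = 2 ^ (m * w - w) * 2 ^ w := by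
    rw [← pow_add]
    congr 1
    omega
  have hmR : (1 : ℝ) ≤ m := by exact_mod_cast hm
  have hA : (0 : ℝ) < 2 ^ (m * w - w) := by positivity
  have hB : (2 : ℝ) ^ (m * w) * (1 - m * (m + 1) / 2 ^ w)
      = 2 ^ (m * w) - 2 ^ (m * w - w) * (m * (m + 1)) := by
    rw [hpw]
    field_simp
  rw [hB]
  have : (1 : ℝ) ≤ m * (m + 1) := by nlinarith
  have := mul_le_mul_of_nonneg_left this hA.le
  linarith
end

section
/- Let C be an n-connector and let R ⊆ V(C) be a subset of its vertices with |R| < n. Then there exists a subset R' of vertices containing only input and output vertices of C, such that |R'| ≤ |R| and Con(R) ⊆ Con(R'). -/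
/-- `l` is a directed path from `a` to `b` in the digraph with edge relation `E`. -/
def IsPathFrom {V : Type*} (E : V → V → Prop) (a b : V) (l : List V) : Prop :=
  l.Chain' E ∧ l.head? = some a ∧ l.getLast? = some b

/-- `ConPairs E inp out R` is the set of pairs `(v, w)` with `v` an input and `w` an output
such that every directed path from `v` to `w` contains a vertex of `R`. -/
def ConPairs {V : Type*} {n : ℕ} (E : V → V → Prop) (inp out : Fin n → V)
    (R : Finset V) : Set (V × V) :=
  {p | (∃ i, p.1 = inp i) ∧ (∃ j, p.2 = out j) ∧
    ∀ l : List V, IsPathFrom E p.1 p.2 l → ∃ x ∈ l, x ∈ R}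

theorem hall_half {α β : Type*} [Fintype α] [Fintype β] [DecidableEq α] [DecidableEq β]
    (M : α → β → Prop) (A : Finset α) (B : Finset β)
    (hc : ∀ a b, M a b → a ∈ A ∨ b ∈ B)
    (hmin : ∀ (A' : Finset α) (B' : Finset β), (∀ a b, M a b → a ∈ A' ∨ b ∈ B') →
      A.card + B.card ≤ A'.card + B'.card) :
    ∃ f : A → β, Function.Injective f ∧ ∀ a, f a ∉ B ∧ M a (f a) := by
  classical
  let t : A → Finset β := fun a => Finset.univ.filter (fun b => b ∉ B ∧ M a b)
  have key : ∀ S : Finset A, S.card ≤ (S.biUnion t).card := by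
    intro S
    have h1 := hmin (A \ S.map (Function.Embedding.subtype _)) (B ∪ S.biUnion t) (by
      intro a b hab
      by_cases hb : b ∈ B
      · right; simp [hb]
      · have ha : a ∈ A := (hc a b hab).resolve_right hb
        by_cases haS : (⟨a, ha⟩ : A) ∈ S
        · right
          refine Finset.mem_union_right _ (Finset.mem_biUnion.2 ⟨_, haS, ?_⟩)
          simp [t, hb, hab]
        · left
          simp [ha, haS])
    have h2 : S.map (Function.Embedding.subtype _) ⊆ A := by
      intro x hx
      simp at hx
      exact hx.1
    have h3 := Finset.card_sdiff_add_card_eq_card h2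
    have h4 := Finset.card_union_le B (S.biUnion t)
    rw [Finset.card_map] at h3
    omega
  obtain ⟨f, hf, hft⟩ := (Finset.all_card_le_biUnion_card_iff_exists_injective t).1 key
  refine ⟨f, hf, fun a => ?_⟩
  have := hft a
  simpa [t] using this

/-- Let `C` be an `n`-connector (a finite DAG with `n` distinguished
inputs and `n` distinguished outputs such that any `k ≤ n` distinct inputs can be joined
to any `k` distinct outputs, in order, by pairwise vertex-disjoint directed paths), and
let `R` be a set of vertices with `|R| < n`. Then there is a set `R'` of vertices
consisting only of inputs and outputs with `|R'| ≤ |R|` and `ConPairs(R) ⊆ ConPairs(R')`. -/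
theorem stmt7 {V : Type*} [Fintype V] [DecidableEq V] (E : V → V → Prop)
    (n : ℕ) (inp out : Fin n → V)
    (hinj_in : Function.Injective inp) (hinj_out : Function.Injective out)
    (hacyc : ∀ v, ¬ Relation.TransGen E v v)
    (hconn : ∀ k, 1 ≤ k → k ≤ n → ∀ s t : Fin k → Fin n,
      Function.Injective s → Function.Injective t →
      ∃ P : Fin k → List V,
        (∀ i, IsPathFrom E (inp (s i)) (out (t i)) (P i)) ∧
        ∀ i j, i ≠ j → ∀ v ∈ P i, v ∉ P j)
    (R : Finset V) (hR : R.card < n) :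
    ∃ R' : Finset V, (↑R' ⊆ Set.range inp ∪ Set.range out) ∧
      R'.card ≤ R.card ∧ ConPairs E inp out R ⊆ ConPairs E inp out R' := by
  classical
  let M : Fin n → Fin n → Prop := fun i j => (inp i, out j) ∈ ConPairs E inp out R
  let C : Set (Finset (Fin n) × Finset (Fin n)) :=
    {p | ∀ a b, M a b → a ∈ p.1 ∨ b ∈ p.2}
  obtain ⟨⟨A, B⟩, hcov, hmin⟩ := Set.exists_min_image C (fun p => p.1.card + p.2.card)
    (Set.toFinite _) ⟨(Finset.univ, Finset.univ), fun a b _ => Or.inl (Finset.mem_univ _)⟩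
  have hcov' : ∀ a b, M a b → a ∈ A ∨ b ∈ B := hcov
  obtain ⟨f, hf, hfM⟩ := hall_half M A B hcov' (fun A' B' h => hmin (A', B') h)
  obtain ⟨g, hg, hgM⟩ := hall_half (fun b a => M a b) B A (fun b a h => (hcov' a b h).symm)
    (fun B' A' h => by
      have := hmin (A', B') (fun a b hab => (h b a hab).symm)
      simp only at this
      omega)
  have hcard : A.card + B.card ≤ R.card := by
    rcases Nat.eq_zero_or_pos (A.card + B.card) with h0 | hpos
    · omega
    let e : Fin (A.card + B.card) ≃ A ⊕ B := (Fintype.equivFinOfCardEq (by simp)).symm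
    let s : A ⊕ B → Fin n := Sum.elim (fun a => a.1) g
    let t : A ⊕ B → Fin n := Sum.elim f (fun b => b.1)
    have hs : Function.Injective s := by
      refine Function.Injective.sumElim Subtype.val_injective hg ?_
      intro a b h
      exact (hgM b).1 (h ▸ a.2)
    have ht : Function.Injective t := by
      refine Function.Injective.sumElim hf Subtype.val_injective ?_
      intro a b h
      exact (hfM a).1 (h ▸ b.2)
    have hM : ∀ x, M (s x) (t x) := by
      rintro (a | b)
      · exact (hfM a).2
      · exact (hgM b).2
    have hk : A.card + B.card ≤ n := by
      have := Fintype.card_le_of_injective _ (hs.comp e.injective)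
      simpa using this
    obtain ⟨P, hP, hdis⟩ := hconn _ hpos hk (s ∘ e) (t ∘ e) (hs.comp e.injective)
      (ht.comp e.injective)
    have hx : ∀ i, ∃ x ∈ P i, x ∈ R := fun i => (hM (e i)).2.2 (P i) (hP i)
    choose x hxP hxR using hx
    have hinj : Function.Injective (fun i => (⟨x i, hxR i⟩ : R)) := by
      intro i j hij
      by_contra hne
      have hij' : x i = x j := congrArg Subtype.val hij
      exact hdis i j hne (x i) (hxP i) (hij' ▸ hxP j)
    have := Fintype.card_le_of_injective _ hinj
    simpa using this
  refine ⟨A.image inp ∪ B.image out, ?_, ?_, ?_⟩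
  · intro v hv
    simp only [Finset.coe_union, Finset.coe_image] at hv
    rcases hv with ⟨a, _, rfl⟩ | ⟨b, _, rfl⟩
    · exact Or.inl ⟨a, rfl⟩
    · exact Or.inr ⟨b, rfl⟩
  · have h1 := Finset.card_union_le (A.image inp) (B.image out)
    have h2 := Finset.card_image_le (s := A) (f := inp)
    have h3 := Finset.card_image_le (s := B) (f := out)
    omega
  · rintro ⟨v, w⟩ hvw
    obtain ⟨⟨i, hi⟩, ⟨j, hj⟩, _⟩ := id hvw
    simp only at hi hj
    subst hi hj
    refine ⟨⟨i, rfl⟩, ⟨j, rfl⟩, fun l hl => ?_⟩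
    rcases hcov' i j hvw with h | h
    · exact ⟨inp i, List.mem_of_mem_head? hl.2.1,
        Finset.mem_union_left _ (Finset.mem_image_of_mem _ h)⟩
    · exact ⟨out j, List.mem_of_mem_getLast? hl.2.2,
        Finset.mem_union_right _ (Finset.mem_image_of_mem _ h)⟩
end

section
/- Let G be a finite DAG that is (a, b)-depth-robust with respect to O(G) ⊆ V(G), let O' ⊆ O(G) be a subset of size a', and let Q be the induced subgraph of G on the set of all vertices that lie on some directed path of G ending in a vertex of O'. Then Q is (a', b)-depth-robust with respect to O'. -/
/-- There is a directed path (w.r.t. `E`) of length at least `γ` (i.e. with at least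
`γ + 1` vertices) ending in `v`, all of whose vertices lie in `A`. -/
def LongPathEndingGe {V : Type*} (E : V → V → Prop) (A : Set V) (v : V) (γ : ℕ) : Prop :=
  ∃ l : List V, l.Chain' E ∧ (∀ x ∈ l, x ∈ A) ∧ l.getLast? = some v ∧ γ < l.length

/-- `G = (V, E)` is `(μ, γ)`-depth-robust w.r.t. `O ⊆ V` (with `|O| = μ`): for every
`R ⊆ V` with `|R| < μ` there is `O' ⊆ O` with `|O'| ≥ μ − |R|` such that every `v ∈ O'`
satisfies `llp(v, G \ R) ≥ γ`. -/
def DepthRobust {V : Type*} [Fintype V] [DecidableEq V] (E : V → V → Prop)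
    (O : Finset V) (μ γ : ℕ) : Prop :=
  O.card = μ ∧ ∀ R : Finset V, R.card < μ →
    ∃ O' ⊆ O, μ - R.card ≤ O'.card ∧ ∀ v ∈ O', LongPathEndingGe E {x | x ∉ R} v γ

theorem chain_reach_aux {V : Type*} (E : V → V → Prop) (v : V) :
    ∀ l : List V, List.IsChain E l → l.getLast? = some v →
      List.IsChain (fun x y => E x y ∧ Relation.ReflTransGen E x v ∧
        Relation.ReflTransGen E y v) l ∧ ∀ x ∈ l.head?, Relation.ReflTransGen E x v
  | [], _, h => by simp at h
  | [x], _, h => by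
    have hx : x = v := by simpa using h
    subst hx
    refine ⟨by simp, ?_⟩
    intro y hy
    have hy' : x = y := by simpa using hy
    subst hy'
    exact Relation.ReflTransGen.refl
  | x :: y :: l, hc, h => by
    rw [List.isChain_cons_cons] at hc
    obtain ⟨h1, h2⟩ := chain_reach_aux E v (y :: l) hc.2 (by simpa using h)
    have hy := h2 y (by simp)
    have hx := Relation.ReflTransGen.head hc.1 hy
    refine ⟨List.isChain_cons_cons.2 ⟨⟨hc.1, hx, hy⟩, h1⟩, ?_⟩
    intro z hz
    have hz' : x = z := by simpa using hz
    subst hz'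
    exact hx

/-- If the finite DAG `G` is `(a, b)`-depth-robust w.r.t. `O(G)`,
`O' ⊆ O(G)` has size `a'`, and `Q` is the induced subgraph of `G` on the vertices that
lie on some directed path of `G` ending in a vertex of `O'` (i.e. the vertices from which
some vertex of `O'` is reachable), then `Q` is `(a', b)`-depth-robust w.r.t. `O'`.
The induced subgraph is represented by restricting the edge relation to that vertex set. -/
theorem stmt10 {V : Type*} [Fintype V] [DecidableEq V] (E : V → V → Prop)
    (O O' : Finset V) (a b a' : ℕ)
    (hac : ∀ v, ¬ Relation.TransGen E v v)
    (h : DepthRobust E O a b) (hsub : O' ⊆ O) (hcard : O'.card = a') :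
    DepthRobust
      (fun x y => E x y ∧ (∃ v ∈ O', Relation.ReflTransGen E x v) ∧
        (∃ v ∈ O', Relation.ReflTransGen E y v))
      O' a' b := by
  refine ⟨hcard, fun R hR => ?_⟩
  obtain ⟨hO, hrob⟩ := h
  have hle := Finset.card_le_card hsub
  obtain ⟨S, hS, hScard, hpath⟩ := hrob R (by omega)
  refine ⟨S ∩ O', Finset.inter_subset_right, ?_, ?_⟩
  · have h1 := Finset.card_union_add_card_inter S O'
    have h2 := Finset.card_le_card (Finset.union_subset hS hsub)
    omega
  · intro v hv
    rw [Finset.mem_inter] at hv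
    obtain ⟨l, hl, hA, hlast, hlen⟩ := hpath v hv.1
    refine ⟨l, ?_, hA, hlast, hlen⟩
    exact (chain_reach_aux E v l hl hlast).1.imp
      (fun x y hxy => ⟨hxy.1, ⟨v, hv.2, hxy.2.1⟩, ⟨v, hv.2, hxy.2.2⟩⟩)
end

section
/- Fix for every k ≥ 0 a 2^k-connector H_k, and let {G_n} be the recursively constructed family of DAGs with base lists Base(G_n) of length 2^n (construction in context). Then for every n and every subset R ⊆ V(G_n) with |R| < 2^n, there exists a directed path L in G_n \ R such that |V(L) ∩ Base(G_n)| ≥ 2^n − |R|. -/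
/-- A family of graphs, where the `k`-th member is intended to be a `2^k`-connector:
a finite DAG with `2^k` distinguished inputs and `2^k` distinguished outputs. -/
structure ConnFam where
  V : ℕ → Type
  fin : ∀ k, Fintype (V k)
  E : ∀ k, V k → V k → Prop
  inp : ∀ k, Fin (2 ^ k) → V k
  out : ∀ k, Fin (2 ^ k) → V k

/-- The `k`-th member is a `2^k`-connector: inputs and outputs are distinguished
(injective lists), the graph is acyclic, and for every `1 ≤ j ≤ 2^k` and every `j`
distinct inputs and `j` distinct outputs there are `j` pairwise vertex-disjoint
directed paths connecting them in order. -/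
def IsConnectorFam (F : ConnFam) : Prop :=
  (∀ k, Function.Injective (F.inp k)) ∧
  (∀ k, Function.Injective (F.out k)) ∧
  (∀ k (v : F.V k), ¬ Relation.TransGen (F.E k) v v) ∧
  (∀ k (j : ℕ), 1 ≤ j → j ≤ 2 ^ k → ∀ s t : Fin j → Fin (2 ^ k),
    Function.Injective s → Function.Injective t →
    ∃ P : Fin j → List (F.V k),
      (∀ i, (P i).Chain' (F.E k) ∧ (P i).head? = some (F.inp k (s i)) ∧
        (P i).getLast? = some (F.out k (t i))) ∧
      ∀ i i', i ≠ i' → ∀ v ∈ P i, v ∉ P i')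

/-- The data of the recursive construction at level `n`:
`GV` is the vertex set of the plain graph `G_n`, `AV` is the set of fresh vertices added
by the augmentation `X ▷ G_n` (the connector copies introduced by the `▷` operator for an
external list `X` of length `2^n`), `EG` is the edge relation of `G_n`, `E` is the edge
relation of `G_n` together with all the edges of `X ▷ G_n` that do not start in `X`,
`base` is the list `Base(G_n)` (of length `2^n`), and `tgt i` is the endpoint inside
`G_n ∪ A_n` of the edge leaving the `i`-th element of `X` in `X ▷ G_n`. -/
structure Blob (n : ℕ) where
  GV : Type
  AV : Type
  EG : GV → GV → Prop
  E : (GV ⊕ AV) → (GV ⊕ AV) → Prop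
  base : Fin (2 ^ n) → GV
  tgt : Fin (2 ^ n) → GV ⊕ AV

/-- Level `0` of the construction: `G_0` is a single node `v`, `Base(G_0) = ⟨v⟩`,
and `X ▷ G_0 = X → Base(G_0)` adds no fresh vertices. -/
def blobZero : Blob 0 where
  GV := Unit
  AV := Empty
  EG := fun _ _ => False
  E := fun _ _ => False
  base := fun _ => ()
  tgt := fun _ => Sum.inl ()

/-- The recursive step of the construction, building `G_{n+1}` (and its
`▷`-augmentation data) from `G_n` and the connector `H_n = F n`:
`G_{n+1}` consists of a left component `L ≅ G_n`, a connector component `C ≅ H_n` and a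
right component `R ≅ G_n` (carried together with its own augmentation vertices), with
`Base(G_{n+1}) = Base(L) : Base(R)`, and edge set
`E(L) ∪ E(C) ∪ E(R) ∪ (Base(L) → In(C)) ∪ E(Out(C) ▷ R)`, where
`(X₁ : X₂) ▷ Y = (X₁ ▷ LS(Y)) ∪ (X₂ →^H In(CS(Y)))` and `I →^H O` attaches a fresh
copy of the connector `H` between `I` and `O`; the augmentation of `G_{n+1}` accordingly
consists of the augmentation of its left component plus one fresh copy of `H_n`. -/
def blobSucc (F : ConnFam) (n : ℕ) (b : Blob n) : Blob (n + 1) :=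
  let GV' := b.GV ⊕ (F.V n ⊕ (b.GV ⊕ b.AV))
  let AV' := b.AV ⊕ F.V n
  let e₁ : b.GV ⊕ b.AV → GV' ⊕ AV' := fun x =>
    match x with
    | Sum.inl g => Sum.inl (Sum.inl g)
    | Sum.inr a => Sum.inr (Sum.inl a)
  let EG' : GV' → GV' → Prop := fun x y =>
    match x, y with
    | Sum.inl a, Sum.inl a' => b.EG a a'
    | Sum.inr (Sum.inl c), Sum.inr (Sum.inl c') => F.E n c c'
    | Sum.inr (Sum.inr u), Sum.inr (Sum.inr u') => b.E u u'
    | Sum.inl a, Sum.inr (Sum.inl c) => ∃ i, a = b.base i ∧ c = F.inp n i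
    | Sum.inr (Sum.inl c), Sum.inr (Sum.inr u) => ∃ i, c = F.out n i ∧ u = b.tgt i
    | _, _ => False
  { GV := GV'
    AV := AV'
    EG := EG'
    E := fun x y =>
      (∃ gx gy, x = Sum.inl gx ∧ y = Sum.inl gy ∧ EG' gx gy) ∨
      (∃ u v, x = e₁ u ∧ y = e₁ v ∧ b.E u v) ∨
      (∃ c c', x = Sum.inr (Sum.inr c) ∧ y = Sum.inr (Sum.inr c') ∧ F.E n c c') ∨
      (∃ i, x = Sum.inr (Sum.inr (F.out n i)) ∧
        y = Sum.inl (Sum.inr (Sum.inl (F.inp n i))))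
    base := fun i =>
      if h : (i : ℕ) < 2 ^ n then Sum.inl (b.base ⟨i, h⟩)
      else Sum.inr (Sum.inr (Sum.inl (b.base ⟨(i : ℕ) - 2 ^ n, by
        have hi := i.isLt
        have key : (2 : ℕ) ^ (n + 1) = 2 ^ n * 2 := pow_succ 2 n
        omega⟩)))
    tgt := fun i =>
      if h : (i : ℕ) < 2 ^ n then e₁ (b.tgt ⟨i, h⟩)
      else Sum.inr (Sum.inr (F.inp n ⟨(i : ℕ) - 2 ^ n, by
        have hi := i.isLt
        have key : (2 : ℕ) ^ (n + 1) = 2 ^ n * 2 := pow_succ 2 n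
        omega⟩)) }

/-- The recursively constructed family `{G_n}` (with augmentation data). -/
def blob (F : ConnFam) : (n : ℕ) → Blob n
  | 0 => blobZero
  | n + 1 => blobSucc F n (blob F n)


open Classical in
/-- number of entries of `l` in `B` -/
noncomputable def cnt {W : Type} (B : Set W) (l : List W) : ℕ := l.countP (fun x => decide (x ∈ B))

lemma cnt_append {W : Type} (B : Set W) (l m : List W) : cnt B (l ++ m) = cnt B l + cnt B m := by
  simp [cnt]

lemma cnt_nil {W : Type} (B : Set W) : cnt B [] = 0 := by
  simp [cnt]

lemma cnt_cons_mem {W : Type} (B : Set W) (x : W) (l : List W) (h : x ∈ B) :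
    cnt B (x :: l) = cnt B l + 1 := by
  simp [cnt, h]

lemma cnt_cons_not_mem {W : Type} (B : Set W) (x : W) (l : List W) (h : x ∉ B) :
    cnt B (x :: l) = cnt B l := by
  simp [cnt, h]

lemma cnt_map {W W' : Type} (B : Set W) (B' : Set W') (f : W → W') (h : ∀ x ∈ B, f x ∈ B')
    (l : List W) : cnt B l ≤ cnt B' (l.map f) := by
  simp only [cnt, List.countP_map]
  apply List.countP_mono_left
  intro x _ hx
  simpa using h x (by simpa using hx)

/-- from `x` there is a walk avoiding `S` with more than `u` entries in `B`. -/
def Gd {W : Type} (E : W → W → Prop) (S B : Set W) (x : W) (u : ℕ) : Prop :=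
  ∃ l : List W, l.IsChain E ∧ l.head? = some x ∧ (∀ v ∈ l, v ∉ S) ∧ u < cnt B l

/-- a walk from `x` to `y` avoiding `S` with at least `e` entries in `B`. -/
def Qd {W : Type} (E : W → W → Prop) (S B : Set W) (x y : W) (e : ℕ) : Prop :=
  ∃ l : List W, l.IsChain E ∧ l.head? = some x ∧ l.getLast? = some y ∧ (∀ v ∈ l, v ∉ S) ∧
    e ≤ cnt B l

lemma Gd.mono {W : Type} {E : W → W → Prop} {S B : Set W} {x : W} {u u' : ℕ}
    (h : Gd E S B x u) (hu : u' ≤ u) : Gd E S B x u' := by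
  obtain ⟨l, h1, h2, h3, h4⟩ := h
  exact ⟨l, h1, h2, h3, by omega⟩

lemma Qd.trans {W : Type} {E : W → W → Prop} {S B : Set W} {x y z : W} {e u : ℕ}
    (h : Qd E S B x y e) (hE : E y z) (h' : Gd E S B z u) : Gd E S B x (e + u) := by
  obtain ⟨l, h1, h2, h3, h4, h5⟩ := h
  obtain ⟨m, k1, k2, k3, k4⟩ := h'
  refine ⟨l ++ m, ?_, ?_, ?_, ?_⟩
  · apply List.IsChain.append h1 k1
    intro a ha b hb
    rw [h3] at ha; rw [k2] at hb
    simp at ha hb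
    subst ha; subst hb; exact hE
  · simp [h2]
  · intro v hv
    rcases List.mem_append.1 hv with hv | hv
    · exact h4 v hv
    · exact k3 v hv
  · rw [cnt_append]; omega

lemma Gd.map {W W' : Type} {E : W → W → Prop} {E' : W' → W' → Prop} {B : Set W} {S' B' : Set W'}
    (f : W → W') (hE : ∀ x y, E x y → E' (f x) (f y)) (hB : ∀ x ∈ B, f x ∈ B')
    {x : W} {u : ℕ} (h : Gd E (f ⁻¹' S') B x u) : Gd E' S' B' (f x) u := by
  obtain ⟨l, h1, h2, h3, h4⟩ := h
  refine ⟨l.map f, List.isChain_map_of_isChain f hE h1, by simp [h2], ?_,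
    lt_of_lt_of_le h4 (cnt_map _ _ f hB l)⟩
  intro v hv
  obtain ⟨w, hw, rfl⟩ := List.mem_map.1 hv
  exact h3 w hw

lemma Qd.map {W W' : Type} {E : W → W → Prop} {E' : W' → W' → Prop} {B : Set W} {S' B' : Set W'}
    (f : W → W') (hE : ∀ x y, E x y → E' (f x) (f y)) (hB : ∀ x ∈ B, f x ∈ B')
    {x y : W} {u : ℕ} (h : Qd E (f ⁻¹' S') B x y u) : Qd E' S' B' (f x) (f y) u := by
  obtain ⟨l, h1, h2, h2', h3, h4⟩ := h
  refine ⟨l.map f, List.isChain_map_of_isChain f hE h1, by simp [h2], by simp [h2'], ?_,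
    le_trans h4 (cnt_map _ _ f hB l)⟩
  intro v hv
  obtain ⟨w, hw, rfl⟩ := List.mem_map.1 hv
  exact h3 w hw

lemma chain_nodup {W : Type} {E : W → W → Prop} (r : W → ℕ) (hr : ∀ x y, E x y → r x < r y)
    {l : List W} (h : l.IsChain E) : l.Nodup := by
  have h1 : l.IsChain (fun x y => r x < r y) := h.imp (fun a b hab => hr a b hab)
  have : Trans (fun x y => r x < r y) (fun x y => r x < r y) (fun x y => r x < r y) :=
    ⟨fun h h' => lt_trans h h'⟩
  have h2 := h1.pairwise
  exact h2.imp (fun {a b} hab => by rintro rfl; exact lt_irrefl _ hab)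

lemma prefixes {W : Type} {E : W → W → Prop} {S B : Set W} (l : List W) :
    ∀ x, l.IsChain E → l.Nodup → l.head? = some x → (∀ v ∈ l, v ∉ S) →
    ∃ y : ℕ → W, (∀ e, 1 ≤ e → e ≤ cnt B l → y e ∈ l ∧ y e ∈ B ∧ Qd E S B x (y e) e) ∧
      (∀ e e', 1 ≤ e → e ≤ cnt B l → 1 ≤ e' → e' ≤ cnt B l → y e = y e' → e = e') := by
  induction l with
  | nil => intro x _ _ h; simp at h
  | cons a l ih =>
    intro x hc hn hx hS
    simp at hx; subst hx
    have hl : ∃ y : ℕ → W, (∀ e, 1 ≤ e → e ≤ cnt B l → y e ∈ l ∧ y e ∈ B ∧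
        ∃ m : List W, (a :: m).IsChain E ∧ (a :: m).getLast? = some (y e) ∧ (∀ v ∈ m, v ∉ S) ∧
          e ≤ cnt B m) ∧
        (∀ e e', 1 ≤ e → e ≤ cnt B l → 1 ≤ e' → e' ≤ cnt B l → y e = y e' → e = e') := by
      cases l with
      | nil => exact ⟨fun _ => a, fun e h1 h2 => by simp [cnt_nil] at h2; omega,
          fun e e' h1 h2 => by simp [cnt_nil] at h2; omega⟩
      | cons b l =>
        obtain ⟨y, hy, hy'⟩ := ih b hc.tail (List.nodup_cons.1 hn).2 rfl
          (fun v hv => hS v (List.mem_cons_of_mem _ hv))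
        refine ⟨y, fun e h1 h2 => ?_, hy'⟩
        obtain ⟨h3, h4, m, m1, m2, m3, m4, m5⟩ := hy e h1 h2
        refine ⟨h3, h4, m, ?_, ?_, m4, m5⟩
        · rw [List.isChain_cons]
          refine ⟨?_, m1⟩
          intro z hz
          rw [m2] at hz
          simp at hz; subst hz
          exact hc.rel_head? (by simp)
        · rw [List.getLast?_cons, m3]; rfl
    obtain ⟨y, hy, hy'⟩ := hl
    have haS : a ∉ S := hS a (by simp)
    have hal : a ∉ l := (List.nodup_cons.1 hn).1
    by_cases ha : a ∈ B
    · refine ⟨fun e => if e = 1 then a else y (e - 1), ?_, ?_⟩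
      · intro e h1 h2
        rw [cnt_cons_mem _ _ _ ha] at h2
        by_cases he : e = 1
        · simp only [he, if_true]
          refine ⟨by simp, ha, [a], by simp, by simp, by simp, by simpa using haS, ?_⟩
          rw [cnt_cons_mem _ _ _ ha]; omega
        · simp only [he, if_false]
          obtain ⟨h3, h4, m, m1, m2, m3, m4⟩ := hy (e - 1) (by omega) (by omega)
          refine ⟨List.mem_cons_of_mem _ h3, h4, a :: m, m1, rfl, m2, ?_, ?_⟩
          · intro v hv
            rcases List.mem_cons.1 hv with rfl | hv
            · exact haS
            · exact m3 v hv
          · rw [cnt_cons_mem _ _ _ ha]; omega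
      · intro e e' h1 h2 h1' h2' heq
        rw [cnt_cons_mem _ _ _ ha] at h2 h2'
        by_cases he : e = 1 <;> by_cases he' : e' = 1
        · omega
        · simp only [he, he', if_true, if_false] at heq
          exact absurd (heq ▸ (hy (e' - 1) (by omega) (by omega)).1) hal
        · simp only [he, he', if_true, if_false] at heq
          exact absurd (heq ▸ (hy (e - 1) (by omega) (by omega)).1) hal
        · simp only [he, he', if_false] at heq
          have := hy' _ _ (by omega) (by omega) (by omega) (by omega) heq
          omega
    · refine ⟨y, ?_, ?_⟩
      · intro e h1 h2
        rw [cnt_cons_not_mem _ _ _ ha] at h2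
        obtain ⟨h3, h4, m, m1, m2, m3, m4⟩ := hy e h1 h2
        refine ⟨List.mem_cons_of_mem _ h3, h4, a :: m, m1, rfl, m2, ?_, ?_⟩
        · intro v hv
          rcases List.mem_cons.1 hv with rfl | hv
          · exact haS
          · exact m3 v hv
        · rw [cnt_cons_not_mem _ _ _ ha]; omega
      · have hfin := hy'
        rw [cnt_cons_not_mem _ _ _ ha]
        exact hfin

/-- Hall type selection. -/
lemma hall_up {α : Type} [Finite α] (k : ℕ) (A : Fin k → Set α)
    (h : ∀ r : Fin k, (r : ℕ) + 1 ≤ (A r).ncard) :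
    ∃ f : Fin k → α, Function.Injective f ∧ ∀ r, f r ∈ A r := by
  classical
  have := Fintype.ofFinite α
  have := (Finset.all_card_le_biUnion_card_iff_exists_injective
    (fun r => (A r).toFinset)).1 (by
      intro s
      rcases s.eq_empty_or_nonempty with rfl | hs
      · simp
      · have hm := s.max'_mem hs
        calc s.card ≤ (Finset.Iic (s.max' hs)).card :=
              Finset.card_le_card (fun x hx => Finset.mem_Iic.2 (s.le_max' x hx))
          _ = (s.max' hs : ℕ) + 1 := by simp
          _ ≤ (A (s.max' hs)).ncard := h _
          _ = (A (s.max' hs)).toFinset.card := Set.ncard_eq_toFinset_card' _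
          _ ≤ _ := Finset.card_le_card (Finset.subset_biUnion_of_mem
                (fun r => (A r).toFinset) hm))
  obtain ⟨f, hf, hf'⟩ := this
  exact ⟨f, hf, fun r => by simpa using hf' r⟩

lemma hall_down {α : Type} [Finite α] (k : ℕ) (A : Fin k → Set α)
    (h : ∀ r : Fin k, k - (r : ℕ) ≤ (A r).ncard) :
    ∃ f : Fin k → α, Function.Injective f ∧ ∀ r, f r ∈ A r := by
  obtain ⟨f, hf, hf'⟩ := hall_up k (fun r => A r.rev) (by
    intro r
    have := h r.rev
    rw [Fin.val_rev] at this
    have := r.isLt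
    omega)
  exact ⟨fun r => f r.rev, hf.comp Fin.rev_injective, fun r => by simpa using hf' r.rev⟩

/-- crossing a connector -/
lemma cross {F : ConnFam} (hF : IsConnectorFam F) (n : ℕ) {W : Type} {E : W → W → Prop}
    {S B : Set W} (f : F.V n → W) (hE : ∀ x y, F.E n x y → E (f x) (f y))
    (y : Fin (2 ^ n) → W) (hy : ∀ i, E (f (F.out n i)) (y i))
    (u : Fin ((f ⁻¹' S).ncard + 1) → ℕ)
    (h1 : ∀ r : Fin ((f ⁻¹' S).ncard + 1), (f ⁻¹' S).ncard + 1 - (r : ℕ) ≤ {j | ¬ Gd E S B (f (F.inp n j)) (u r)}.ncard)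
    (h2 : ∀ r : Fin ((f ⁻¹' S).ncard + 1), (r : ℕ) + 1 ≤ {j | Gd E S B (y j) (u r)}.ncard) :
    False := by
  have := F.fin n
  obtain ⟨a, ha, ha'⟩ := hall_down _ _ h1
  obtain ⟨o, ho, ho'⟩ := hall_up _ _ h2
  have hk : (f ⁻¹' S).ncard + 1 ≤ 2 ^ n := by
    simpa using Fintype.card_le_of_injective a ha
  obtain ⟨P, hP, hd⟩ := hF.2.2.2 n _ (by omega) hk a o ha ho
  have key : ∀ r, ∃ v ∈ P r, v ∈ f ⁻¹' S := by
    intro r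
    by_contra hcon
    push Not at hcon
    obtain ⟨p1, p2, p3⟩ := hP r
    have hq : Qd E S B (f (F.inp n (a r))) (f (F.out n (o r))) 0 :=
      Qd.map (B := ∅) f hE (by simp) ⟨P r, p1, p2, p3, hcon, Nat.zero_le _⟩
    have := hq.trans (hy (o r)) (ho' r)
    exact ha' r (by simpa using this)
  choose v hv hv' using key
  have hinj : Function.Injective v := by
    intro r r' hrr
    by_contra hne
    exact hd r r' hne (v r) (hv r) (hrr ▸ hv r')
  have : (Set.range v).ncard ≤ (f ⁻¹' S).ncard :=
    Set.ncard_le_ncard (by rintro _ ⟨r, rfl⟩; exact hv' r) (Set.toFinite _)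
  rw [← Set.image_univ, Set.ncard_image_of_injective _ hinj, Set.ncard_univ] at this
  simp at this

lemma conn_rank {F : ConnFam} (hF : IsConnectorFam F) (n : ℕ) :
    ∃ (r : F.V n → ℕ) (M : ℕ), (∀ x, r x < M) ∧ ∀ x y, F.E n x y → r x < r y := by
  have := F.fin n
  refine ⟨fun v => {u | Relation.TransGen (F.E n) u v}.ncard, Fintype.card (F.V n) + 1, ?_, ?_⟩
  · intro x
    have := Set.ncard_le_card {u | Relation.TransGen (F.E n) u x}
    rw [Nat.card_eq_fintype_card] at this
    exact Nat.lt_succ_of_le this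
  · intro x y hxy
    apply Set.ncard_lt_ncard _ (Set.toFinite _)
    refine ⟨fun u hu => Relation.TransGen.tail hu hxy, fun hsub => ?_⟩
    exact hF.2.2.1 n x (hsub (Relation.TransGen.single hxy))

/-- inclusion of the augmented left component -/
def eL (F : ConnFam) (n : ℕ) (b : Blob n) :
    b.GV ⊕ b.AV → (blobSucc F n b).GV ⊕ (blobSucc F n b).AV := fun x =>
  match x with
  | Sum.inl g => Sum.inl (Sum.inl g)
  | Sum.inr a => Sum.inr (Sum.inl a)

/-- inclusion of the augmented right component -/
def eR (F : ConnFam) (n : ℕ) (b : Blob n) :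
    b.GV ⊕ b.AV → (blobSucc F n b).GV ⊕ (blobSucc F n b).AV := fun x =>
  Sum.inl (Sum.inr (Sum.inr x))

/-- inclusion of the connector component -/
def eC (F : ConnFam) (n : ℕ) (b : Blob n) :
    F.V n → (blobSucc F n b).GV ⊕ (blobSucc F n b).AV := fun x =>
  Sum.inl (Sum.inr (Sum.inl x))

/-- inclusion of the fresh connector -/
def eH (F : ConnFam) (n : ℕ) (b : Blob n) :
    F.V n → (blobSucc F n b).GV ⊕ (blobSucc F n b).AV := fun x =>
  Sum.inr (Sum.inr x)

/-- base vertices in the augmented graph -/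
def BS {n : ℕ} (b : Blob n) : Set (b.GV ⊕ b.AV) := Set.range (fun i => Sum.inl (b.base i))

section step
variable (F : ConnFam) (n : ℕ) (b : Blob n)

lemma E_eL (u v) (h : b.E u v) : (blobSucc F n b).E (eL F n b u) (eL F n b v) :=
  Or.inr (Or.inl ⟨u, v, rfl, rfl, h⟩)

lemma E_eR (u v) (h : b.E u v) : (blobSucc F n b).E (eR F n b u) (eR F n b v) :=
  Or.inl ⟨_, _, rfl, rfl, h⟩

lemma E_eC (u v) (h : F.E n u v) : (blobSucc F n b).E (eC F n b u) (eC F n b v) :=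
  Or.inl ⟨_, _, rfl, rfl, h⟩

lemma E_eH (u v) (h : F.E n u v) : (blobSucc F n b).E (eH F n b u) (eH F n b v) :=
  Or.inr (Or.inr (Or.inl ⟨u, v, rfl, rfl, h⟩))

lemma E_LC (i) : (blobSucc F n b).E (eL F n b (Sum.inl (b.base i))) (eC F n b (F.inp n i)) :=
  Or.inl ⟨Sum.inl (b.base i), Sum.inr (Sum.inl (F.inp n i)), rfl, rfl, ⟨i, rfl, rfl⟩⟩

lemma E_CR (i) : (blobSucc F n b).E (eC F n b (F.out n i)) (eR F n b (b.tgt i)) :=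
  Or.inl ⟨_, _, rfl, rfl, ⟨i, rfl, rfl⟩⟩

lemma E_HC (i) : (blobSucc F n b).E (eH F n b (F.out n i)) (eC F n b (F.inp n i)) :=
  Or.inr (Or.inr (Or.inr ⟨i, rfl, rfl⟩))

lemma BS_eL (x) (h : x ∈ BS b) : eL F n b x ∈ BS (blobSucc F n b) := by
  obtain ⟨i, rfl⟩ := h
  have key : (2 : ℕ) ^ (n + 1) = 2 ^ n * 2 := pow_succ 2 n
  have hi := i.isLt
  refine ⟨⟨i, by omega⟩, ?_⟩
  simp only [blobSucc, hi, dif_pos]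
  rfl

lemma BS_eR (x) (h : x ∈ BS b) : eR F n b x ∈ BS (blobSucc F n b) := by
  obtain ⟨i, rfl⟩ := h
  have key : (2 : ℕ) ^ (n + 1) = 2 ^ n * 2 := pow_succ 2 n
  have hi := i.isLt
  refine ⟨⟨2 ^ n + i, by omega⟩, ?_⟩
  have : ¬ (2 ^ n + (i : ℕ) < 2 ^ n) := by omega
  simp only [blobSucc, this, dif_neg, not_false_eq_true, Nat.add_sub_cancel_left]
  rfl

lemma tgt_bad (p : (blobSucc F n b).GV ⊕ (blobSucc F n b).AV → Prop) :
    {i | p ((blobSucc F n b).tgt i)}.ncard ≤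
      {i | p (eL F n b (b.tgt i))}.ncard + {i | p (eH F n b (F.inp n i))}.ncard := by
  have key : (2 : ℕ) ^ (n + 1) = 2 ^ n * 2 := pow_succ 2 n
  let f1 : Fin (2 ^ n) → Fin (2 ^ (n + 1)) := fun i => ⟨i, by omega⟩
  let f2 : Fin (2 ^ n) → Fin (2 ^ (n + 1)) := fun i => ⟨2 ^ n + i, by omega⟩
  have hsub : {i | p ((blobSucc F n b).tgt i)} ⊆
      f1 '' {i | p (eL F n b (b.tgt i))} ∪ f2 '' {i | p (eH F n b (F.inp n i))} := by
    intro i hi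
    by_cases h : (i : ℕ) < 2 ^ n
    · left
      refine ⟨⟨i, h⟩, ?_, rfl⟩
      have : (blobSucc F n b).tgt i = eL F n b (b.tgt ⟨i, h⟩) := by
        simp only [blobSucc, h, dif_pos]
        rfl
      simpa [this] using hi
    · right
      refine ⟨⟨i - 2 ^ n, by omega⟩, ?_, ?_⟩
      · have : (blobSucc F n b).tgt i = eH F n b (F.inp n ⟨i - 2 ^ n, by omega⟩) := by
          simp only [blobSucc, h, dif_neg, not_false_eq_true]
          rfl
        simpa [this] using hi
      · ext; simp only [f2]; omega
  calc _ ≤ _ := Set.ncard_le_ncard hsub (Set.toFinite _)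
    _ ≤ _ := Set.ncard_union_le _ _
    _ ≤ _ := add_le_add (Set.ncard_image_le (Set.toFinite _)) (Set.ncard_image_le (Set.toFinite _))

lemma iL : Function.Injective (eL F n b) := by
  intro x y h
  rcases x with x | x <;> rcases y with y | y
  · exact congrArg _ (Sum.inl.inj (Sum.inl.inj h))
  · exact absurd h Sum.inl_ne_inr
  · exact absurd h Sum.inr_ne_inl
  · exact congrArg _ (Sum.inl.inj (Sum.inr.inj h))

lemma iR : Function.Injective (eR F n b) :=
  fun _ _ h => Sum.inr.inj (Sum.inr.inj (Sum.inl.inj h))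

lemma iC : Function.Injective (eC F n b) :=
  fun _ _ h => Sum.inl.inj (Sum.inr.inj (Sum.inl.inj h))

lemma iH : Function.Injective (eH F n b) :=
  fun _ _ h => Sum.inr.inj (Sum.inr.inj h)

lemma ncard_parts (S : Set ((blobSucc F n b).GV ⊕ (blobSucc F n b).AV)) (hS : S.Finite) :
    (eL F n b ⁻¹' S).ncard + (eH F n b ⁻¹' S).ncard + (eC F n b ⁻¹' S).ncard
      + (eR F n b ⁻¹' S).ncard ≤ S.ncard := by
  have iL := iL F n b
  have iR := iR F n b
  have iC := iC F n b
  have iH := iH F n b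
  have fL := hS.preimage (iL.injOn)
  have fR := hS.preimage (iR.injOn)
  have fC := hS.preimage (iC.injOn)
  have fH := hS.preimage (iH.injOn)
  rw [← Set.ncard_image_of_injective (eL F n b ⁻¹' S) iL, ← Set.ncard_image_of_injective (eR F n b ⁻¹' S) iR,
    ← Set.ncard_image_of_injective (eC F n b ⁻¹' S) iC, ← Set.ncard_image_of_injective (eH F n b ⁻¹' S) iH]
  rw [← Set.ncard_union_eq _ (fL.image _) (fH.image _),
    ← Set.ncard_union_eq _ ((fL.image _).union (fH.image _)) (fC.image _),
    ← Set.ncard_union_eq _ (((fL.image _).union (fH.image _)).union (fC.image _)) (fR.image _)]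
  · apply Set.ncard_le_ncard _ hS
    rintro _ (((⟨x, hx, rfl⟩ | ⟨x, hx, rfl⟩) | ⟨x, hx, rfl⟩) | ⟨x, hx, rfl⟩) <;> exact hx
  · rw [Set.disjoint_left]
    rintro _ ((⟨x, -, rfl⟩ | ⟨x, -, rfl⟩) | ⟨x, -, rfl⟩) ⟨y, -, h⟩
    · rcases x with x | x
      · exact Sum.inr_ne_inl (Sum.inl.inj h)
      · exact Sum.inl_ne_inr h
    · exact Sum.inl_ne_inr h
    · exact Sum.inr_ne_inl (Sum.inr.inj (Sum.inl.inj h))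
  · rw [Set.disjoint_left]
    rintro _ (⟨x, -, rfl⟩ | ⟨x, -, rfl⟩) ⟨y, -, h⟩
    · rcases x with x | x
      · exact Sum.inr_ne_inl (Sum.inl.inj h)
      · exact Sum.inl_ne_inr h
    · exact Sum.inl_ne_inr h
  · rw [Set.disjoint_left]
    rintro _ ⟨x, -, rfl⟩ ⟨y, -, h⟩
    rcases x with x | x
    · exact Sum.inr_ne_inl h
    · exact Sum.inr_ne_inl (Sum.inr.inj h)

end step

/-- acyclicity through a bounded rank function, plus compatibility of `E` with `EG` -/
def RankOK {n : ℕ} (b : Blob n) : Prop :=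
  (∃ (r : b.GV ⊕ b.AV → ℕ) (M : ℕ), (∀ x, r x < M) ∧ ∀ x y, b.E x y → r x < r y) ∧
  (∀ x y, b.E (Sum.inl x) (Sum.inl y) → b.EG x y) ∧
  (∀ x y, ¬ b.E (Sum.inl x) (Sum.inr y)) ∧ ∀ x y, b.EG x y → b.E (Sum.inl x) (Sum.inl y)

lemma rank_zero : RankOK blobZero :=
  ⟨⟨fun _ => 0, 1, fun _ => Nat.one_pos, fun _ _ h => h.elim⟩, fun _ _ h => h.elim,
    fun _ _ h => h.elim, fun _ _ h => h.elim⟩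

lemma rank_succ {F : ConnFam} (hF : IsConnectorFam F) (n : ℕ) (b : Blob n) (hb : RankOK b) :
    RankOK (blobSucc F n b) := by
  obtain ⟨⟨r, M, hM, hr⟩, h1, h2, h3⟩ := hb
  obtain ⟨q, K, hK, hq⟩ := conn_rank hF n
  have hEG : ∀ x y, (blobSucc F n b).E (Sum.inl x) (Sum.inl y) → (blobSucc F n b).EG x y := by
    rintro x y (⟨gx, gy, hx, hy, h⟩ | ⟨u, v, hx, hy, h⟩ | ⟨c, c', hx, hy, h⟩ | ⟨i, hx, hy⟩)
    · cases hx; cases hy; exact h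
    · rcases u with u | u <;> rcases v with v | v <;>
        first | exact absurd hx Sum.inl_ne_inr | exact absurd hy Sum.inl_ne_inr | skip
      cases Sum.inl.inj hx; cases Sum.inl.inj hy
      exact h1 _ _ h
    · cases hx
    · cases hx
  refine ⟨⟨fun x => match x with
    | Sum.inl (Sum.inl g) => r (Sum.inl g)
    | Sum.inr (Sum.inl a) => r (Sum.inr a)
    | Sum.inr (Sum.inr h) => q h
    | Sum.inl (Sum.inr (Sum.inl c)) => M + K + q c
    | Sum.inl (Sum.inr (Sum.inr u)) => M + K + K + r u, M + K + K + M, ?_, ?_⟩, hEG, ?_, ?_⟩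
  · rintro ((g | c | u) | a | h)
    · have := hM (Sum.inl g); dsimp only; omega
    · have := hK c; dsimp only; omega
    · have := hM u; dsimp only; omega
    · have := hM (Sum.inr a); dsimp only; omega
    · have := hK h; dsimp only; omega
  · rintro x y (⟨gx, gy, rfl, rfl, h⟩ | ⟨u, v, rfl, rfl, h⟩ | ⟨c, c', rfl, rfl, h⟩ | ⟨i, rfl, rfl⟩)
    · rcases gx with g | c | u <;> rcases gy with g' | c' | u' <;> dsimp only at h ⊢
      · exact hr _ _ (h3 _ _ h)
      · have := hM (Sum.inl g); omega
      · have := hq _ _ h; omega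
      · have := hK c; omega
      · have := hr _ _ h; omega
    · have := hr _ _ h
      rcases u with u | u <;> rcases v with v | v <;> exact this
    · exact hq _ _ h
    · have := hK (F.out n i); dsimp only; omega
  · rintro x y (⟨gx, gy, hx, hy, h⟩ | ⟨u, v, hx, hy, h⟩ | ⟨c, c', hx, hy, h⟩ | ⟨i, hx, hy⟩)
    · cases hy
    · rcases u with u | u <;> rcases v with v | v <;>
        first | exact absurd hx Sum.inl_ne_inr | exact absurd hy Sum.inr_ne_inl | skip
      exact h2 _ _ h
    · cases hx
    · cases hx
  · intro x y h
    exact Or.inl ⟨x, y, rfl, rfl, h⟩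

/-- the inductive claim -/
def Claim {n : ℕ} (b : Blob n) : Prop :=
  ∀ (S : Set (b.GV ⊕ b.AV)), S.Finite → ∀ t : ℕ,
    {i | ¬ Gd b.E S (BS b) (b.tgt i) t}.ncard ≤ S.ncard + t

lemma claim_zero : Claim blobZero := by
  intro S hS t
  have hle : {i | ¬ Gd blobZero.E S (BS blobZero) (blobZero.tgt i) t}.ncard ≤ 1 := by
    simpa using Set.ncard_le_card {i | ¬ Gd blobZero.E S (BS blobZero) (blobZero.tgt i) t}
  by_cases h : S.ncard + t = 0
  · have h1 : S.ncard = 0 := by omega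
    have h2 : t = 0 := by omega
    rw [Set.ncard_eq_zero hS] at h1
    subst h1; subst h2
    have : {i | ¬ Gd blobZero.E ∅ (BS blobZero) (blobZero.tgt i) 0} = ∅ := by
      ext i
      simp only [Set.mem_ofPred_eq, Set.mem_empty_iff_false, iff_false, not_not]
      refine ⟨[blobZero.tgt i], by simp, by simp, by simp, ?_⟩
      rw [cnt_cons_mem (BS blobZero) (blobZero.tgt i) [] ⟨i, rfl⟩]
      omega
    rw [this]; simp
  · omega

lemma claim_succ {F : ConnFam} (hF : IsConnectorFam F) (n : ℕ) (b : Blob n) (hb : RankOK b)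
    (hC : Claim b) : Claim (blobSucc F n b) := by
  intro S hS t
  have hparts := ncard_parts F n b S hS
  have htgt := tgt_bad F n b (fun x => ¬ Gd (blobSucc F n b).E S (BS (blobSucc F n b)) x t)
  set E := (blobSucc F n b).E with hE
  set B := BS (blobSucc F n b) with hB
  have finL : (eL F n b ⁻¹' S).Finite := hS.preimage (iL F n b).injOn
  have finR : (eR F n b ⁻¹' S).Finite := hS.preimage (iR F n b).injOn
  set sL := (eL F n b ⁻¹' S).ncard with hsL
  set sR := (eR F n b ⁻¹' S).ncard with hsR
  set sC := (eC F n b ⁻¹' S).ncard with hsC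
  set sH := (eH F n b ⁻¹' S).ncard with hsH
  -- left component
  have hL : ∀ u, {i | ¬ Gd b.E (eL F n b ⁻¹' S) (BS b) (b.tgt i) u}.ncard ≤ sL + u :=
    hC _ finL
  have hLmap : ∀ i u, Gd b.E (eL F n b ⁻¹' S) (BS b) (b.tgt i) u →
      Gd E S B (eL F n b (b.tgt i)) u := fun i u h =>
    Gd.map (eL F n b) (E_eL F n b) (BS_eL F n b) h
  have hL' : ∀ u, (∀ i, Gd b.E (eL F n b ⁻¹' S) (BS b) (b.tgt i) u →
      Gd E S B (eL F n b (b.tgt i)) t) →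
      {i | ¬ Gd E S B (eL F n b (b.tgt i)) t}.ncard ≤ sL + u := by
    intro u h
    exact le_trans (Set.ncard_le_ncard (fun i hi hg => hi (h i hg)) (Set.toFinite _)) (hL u)
  -- complement counting
  have hcompl : ∀ (p : Fin (2 ^ n) → Prop), {i | p i}.ncard + {i | ¬ p i}.ncard = 2 ^ n := by
    intro p
    have := Set.ncard_add_ncard_compl {i | p i}
    simpa [Set.compl_ofPred] using this
  -- right component
  have hR : ∀ u, 2 ^ n ≤ sR + u + {i | Gd E S B (eR F n b (b.tgt i)) u}.ncard := by
    intro u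
    have h1 := hC _ finR u
    have h2 := hcompl (fun i => Gd b.E (eR F n b ⁻¹' S) (BS b) (b.tgt i) u)
    have h3 : {i | Gd b.E (eR F n b ⁻¹' S) (BS b) (b.tgt i) u}.ncard ≤
        {i | Gd E S B (eR F n b (b.tgt i)) u}.ncard :=
      Set.ncard_le_ncard (fun i hi => Gd.map (eR F n b) (E_eR F n b) (BS_eR F n b) hi)
        (Set.toFinite _)
    omega
  have hT : {i | ¬ Gd E S B (eH F n b (F.inp n i)) t}.ncard ≤ 2 ^ n := by
    have := hcompl (fun i => Gd E S B (eH F n b (F.inp n i)) t)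
    omega
  by_cases c1 : {i | ¬ Gd E S B (eH F n b (F.inp n i)) t}.ncard ≤ sH
  · have := hL' t (fun i h => hLmap i t h)
    omega
  -- many bad inputs of the fresh connector
  have c2 : {i | Gd E S B (eC F n b (F.inp n i)) t}.ncard ≤ sH := by
    by_contra hcon
    refine cross hF n (E := E) (S := S) (B := B) (eH F n b) (E_eH F n b)
      (fun i => eC F n b (F.inp n i)) (E_HC F n b) (fun _ => t) ?_ ?_
    · intro r; omega
    · intro r; have := r.isLt; omega
  have c2' := hcompl (fun i => Gd E S B (eC F n b (F.inp n i)) t)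
  by_cases c3 : {i | ¬ Gd E S B (eC F n b (F.inp n i)) t}.ncard ≤ sC
  · have := hL' t (fun i h => hLmap i t h)
    omega
  have c4 : 2 ^ n ≤ sR + t + sC := by
    by_contra hcon
    refine cross hF n (E := E) (S := S) (B := B) (eC F n b) (E_eC F n b)
      (fun i => eR F n b (b.tgt i)) (E_CR F n b) (fun _ => t) ?_ ?_
    · intro r; omega
    · intro r; have := r.isLt; have := hR t; omega
  obtain ⟨τ, hτ⟩ : ∃ τ, sR + t + sC = 2 ^ n + τ := ⟨sR + t + sC - 2 ^ n, by omega⟩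
  have := hL' τ (by
    intro i hi
    by_contra hbad
    have hτt : τ < t := by
      by_contra hcon
      exact hbad (hLmap i t (hi.mono (by omega)))
    obtain ⟨l, l1, l2, l3, l4⟩ := hi
    obtain ⟨⟨r, M, hM, hr⟩, -⟩ := hb
    obtain ⟨y, hy, hy'⟩ := prefixes (B := BS b) l _ l1 (chain_nodup r hr l1) l2 l3
    have hidx : ∀ e, ∃ j, 1 ≤ e → e ≤ τ + 1 → y e = Sum.inl (b.base j) := by
      intro e
      by_cases h : 1 ≤ e ∧ e ≤ τ + 1
      · obtain ⟨j, hj⟩ := (hy e h.1 (by omega)).2.1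
        exact ⟨j, fun _ _ => hj.symm⟩
      · exact ⟨⟨0, by positivity⟩, fun h1 h2 => absurd ⟨h1, h2⟩ h⟩
    choose j hj using hidx
    have hjinj : ∀ e e', 1 ≤ e → e ≤ τ + 1 → 1 ≤ e' → e' ≤ τ + 1 → j e = j e' → e = e' := by
      intro e e' h1 h2 h3 h4 h
      apply hy' e e' h1 (by omega) h3 (by omega)
      rw [hj e h1 h2, hj e' h3 h4, h]
    have hjbad : ∀ e, 1 ≤ e → e ≤ τ + 1 → ¬ Gd E S B (eC F n b (F.inp n (j e))) (t - e) := by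
      intro e h1 h2 hg
      have hq := (hy e h1 (by omega)).2.2
      rw [hj e h1 h2] at hq
      have hq' : Qd E S B _ _ e := Qd.map (eL F n b) (E_eL F n b) (BS_eL F n b) hq
      have := hq'.trans (E_LC F n b (j e)) hg
      rw [show e + (t - e) = t by omega] at this
      exact hbad this
    refine cross hF n (E := E) (S := S) (B := B) (eC F n b) (E_eC F n b)
      (fun i => eR F n b (b.tgt i)) (E_CR F n b) (fun r => t - ((r : ℕ) + 1 + τ - sC)) ?_ ?_
    · intro r
      have hrlt := r.isLt
      by_cases he : (r : ℕ) + 1 + τ - sC = 0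
      · simp only [he, Nat.sub_zero]
        omega
      · set e := (r : ℕ) + 1 + τ - sC with hee
        have himg : (j '' (Finset.Icc e (τ + 1) : Finset ℕ)).ncard = τ + 1 + 1 - e := by
          rw [Set.InjOn.ncard_image, Set.ncard_coe_finset, Nat.card_Icc]
          intro p hp p' hp' hpp
          simp only [Finset.coe_Icc, Set.mem_Icc] at hp hp'
          exact hjinj p p' (by omega) (by omega) (by omega) (by omega) hpp
        have hle : (j '' (Finset.Icc e (τ + 1) : Finset ℕ)).ncard ≤
            {i | ¬ Gd E S B (eC F n b (F.inp n i)) (t - e)}.ncard := by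
          apply Set.ncard_le_ncard _ (Set.toFinite _)
          rintro _ ⟨p, hp, rfl⟩
          simp only [Finset.coe_Icc, Set.mem_Icc] at hp
          intro hg
          exact hjbad p (by omega) (by omega) (hg.mono (by omega))
        omega
    · intro r
      have hrlt := r.isLt
      have := hR (t - ((r : ℕ) + 1 + τ - sC))
      omega)
  omega

lemma claim_all {F : ConnFam} (hF : IsConnectorFam F) (n : ℕ) :
    RankOK (blob F n) ∧ Claim (blob F n) := by
  induction n with
  | zero => exact ⟨rank_zero, claim_zero⟩
  | succ n ih => exact ⟨rank_succ hF n _ ih.1, claim_succ hF n _ ih.1 ih.2⟩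

lemma strip {n : ℕ} (b : Blob n) (hb : RankOK b) (l : List (b.GV ⊕ b.AV)) :
    l.IsChain b.E → ∃ m : List b.GV, m.IsChain b.EG ∧ (∀ v ∈ m, Sum.inl v ∈ l) ∧
      cnt (BS b) l ≤ cnt (Set.range b.base) m ∧
      ∀ x, l.head? = some (Sum.inl x) → m.head? = some x := by
  induction l with
  | nil => exact fun _ => ⟨[], by simp, by simp, by simp [cnt_nil], by simp⟩
  | cons a l ih =>
    intro hc
    obtain ⟨m, m1, m2, m3, m4⟩ := ih hc.tail
    rcases a with a | a
    · have hnext : m.head? = none ∨ ∃ x, m.head? = some x ∧ b.EG a x := by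
        cases hl : l with
        | nil =>
          left
          subst hl
          cases m with
          | nil => rfl
          | cons z m => exact absurd (m2 z (by simp)) (by simp)
        | cons z l' =>
          subst hl
          have hE : b.E (Sum.inl a) z := hc.rel_head? (by simp)
          rcases z with z | z
          · exact Or.inr ⟨z, m4 z rfl, hb.2.1 _ _ hE⟩
          · exact absurd hE (hb.2.2.1 _ _)
      refine ⟨a :: m, ?_, ?_, ?_, by simp⟩
      · rw [List.isChain_cons]
        refine ⟨?_, m1⟩
        intro y hy
        rcases hnext with h | ⟨x, h, hx⟩
        · simp [h] at hy
        · simp [h] at hy; subst hy; exact hx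
      · intro v hv
        rcases List.mem_cons.1 hv with rfl | hv
        · simp
        · exact List.mem_cons_of_mem _ (m2 v hv)
      · by_cases h : a ∈ Set.range b.base
        · have h' : (Sum.inl a : b.GV ⊕ b.AV) ∈ BS b := by
            obtain ⟨i, rfl⟩ := h; exact ⟨i, rfl⟩
          rw [cnt_cons_mem _ _ _ h, cnt_cons_mem _ _ _ h']; omega
        · have h' : (Sum.inl a : b.GV ⊕ b.AV) ∉ BS b := by
            rintro ⟨i, hi⟩; exact h ⟨i, Sum.inl_injective hi⟩
          rw [cnt_cons_not_mem _ _ _ h, cnt_cons_not_mem _ _ _ h']; omega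
    · refine ⟨m, m1, fun v hv => List.mem_cons_of_mem _ (m2 v hv), ?_, by simp⟩
      have h' : (Sum.inr a : b.GV ⊕ b.AV) ∉ BS b := by
        rintro ⟨i, hi⟩; cases hi
      rw [cnt_cons_not_mem _ _ _ h']; exact m3

lemma cnt_ncard {W : Type} (B : Set W) (l : List W) (h : l.Nodup) :
    cnt B l ≤ ({v | v ∈ l} ∩ B).ncard := by
  classical
  have : ({v | v ∈ l} ∩ B) = ((l.filter (fun x => decide (x ∈ B))).toFinset : Set W) := by
    ext v; simp
  rw [this, Set.ncard_coe_finset, List.toFinset_card_of_nodup (h.filter _), cnt,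
    List.countP_eq_length_filter]

/-- Fix a `2^k`-connector `H_k` for each `k ≥ 0`, and let `{G_n}` be
the recursively constructed family of DAGs with base lists `Base(G_n)` of length `2^n`.
Then for every `n` and every set `R` of vertices of `G_n` with `|R| < 2^n`, there is a
directed path `L` in `G_n \ R` with `|V(L) ∩ Base(G_n)| ≥ 2^n − |R|`. -/
theorem stmt11 (F : ConnFam) (hF : IsConnectorFam F) (n : ℕ)
    (R : Set (blob F n).GV) (hfin : R.Finite) (hcard : R.ncard < 2 ^ n) :
    ∃ l : List (blob F n).GV, l.Chain' (blob F n).EG ∧ l.Nodup ∧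
      (∀ x ∈ l, x ∉ R) ∧
      2 ^ n - R.ncard ≤ ({v | v ∈ l} ∩ Set.range (blob F n).base).ncard := by
  obtain ⟨hb, hC⟩ := claim_all hF n
  have h1 := hC (Sum.inl '' R) (hfin.image _) (2 ^ n - 1 - R.ncard)
  rw [Set.ncard_image_of_injective _ Sum.inl_injective] at h1
  obtain ⟨i, hi⟩ : ∃ i, Gd (blob F n).E (Sum.inl '' R) (BS (blob F n)) ((blob F n).tgt i)
      (2 ^ n - 1 - R.ncard) := by
    by_contra hcon
    push Not at hcon
    have : {i | ¬ Gd (blob F n).E (Sum.inl '' R) (BS (blob F n)) ((blob F n).tgt i)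
      (2 ^ n - 1 - R.ncard)} = Set.univ := Set.eq_univ_of_forall hcon
    rw [this, Set.ncard_univ, Nat.card_eq_fintype_card, Fintype.card_fin] at h1
    omega
  obtain ⟨l, l1, l2, l3, l4⟩ := hi
  obtain ⟨m, m1, m2, m3, -⟩ := strip _ hb l l1
  obtain ⟨⟨r, M, hM, hr⟩, -, -, h3⟩ := hb
  have hnd : m.Nodup := chain_nodup (fun x => r (Sum.inl x))
    (fun x y h => hr _ _ (h3 x y h)) m1
  refine ⟨m, m1, hnd, ?_, ?_⟩
  · intro x hx hR
    exact l3 _ (m2 x hx) ⟨x, hR, rfl⟩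
  · have := cnt_ncard (Set.range (blob F n).base) m hnd
    omega
end
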